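/- arXiv:1205.6072 — 5 statements merged into one kernel-verified Lean document; each statement's English description precedes it below -/
import Mathlib

section
/- Let ⊤ be a monad on a category C. If C is cocomplete and the Eilenberg–Moore category C^⊤ of ⊤-algebras has coequalizers, then C^⊤ is cocomplete. -/
open CategoryTheory Limits

universe v u

/-- If the components of the counit of an adjunction are regular epimorphisms, then so are
the components of the counit of the induced adjunction between functor categories. -/
def CategoryTheory.Adjunction.whiskerRightCounitRegularEpi {B D : Type*} [Category* B]
    [Category* D] {F : B ⥤ D} {G : D ⥤ B} (adj : F ⊣ G)
    (h : ∀ X, RegularEpi (adj.counit.app X)) (J : Type*) [Category* J] (X : J ⥤ D) :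
    RegularEpi ((adj.whiskerRight J).counit.app X) where
  W := _
  left := _
  right := _
  w := (adj.whiskerRight J).counit_naturality ((adj.whiskerRight J).counit.app X)
  isColimit := evaluationJointlyReflectsColimits _ fun j =>
    (isColimitMapCoconeCoforkEquiv ((evaluation J D).obj j) _).symm <| by
      refine Cofork.isColimitEquivOfIsos
        (Cofork.ofπ (adj.counit.app (X.obj j)) (adj.counit_naturality _)) _
        (Iso.refl (F.obj (G.obj (F.obj (G.obj (X.obj j))))))
        (Iso.refl (F.obj (G.obj (X.obj j)))) ?_ ?_ ?_ ?_
        (LiftLeftAdjoint.counitCoequalises adj h (X.obj j))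
      · exact Iso.refl (X.obj j)
      all_goals simp

/-- Each component of the counit of the free-forgetful adjunction of a monad is a regular
epimorphism. -/
def CategoryTheory.Monad.adjCounitRegularEpi {C : Type*} [Category* C] (T : Monad C)
    (X : T.Algebra) : RegularEpi (T.adj.counit.app X) := by
  rw [Monad.adj_counit]
  exact ⟨_, _, _, _, Monad.beckAlgebraCoequalizer X⟩

theorem CategoryTheory.Monad.hasColimitsOfShape_algebra {C : Type*} [Category* C] (T : Monad C)
    (J : Type*) [Category* J] [HasColimitsOfShape J C] [HasReflexiveCoequalizers T.Algebra] :
    HasColimitsOfShape J T.Algebra := by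
  rw [hasColimitsOfShape_iff_isRightAdjoint_const]
  have : (Functor.const J : C ⥤ _).IsRightAdjoint :=
    hasColimitsOfShape_iff_isRightAdjoint_const.1 inferInstance
  have : (Functor.const J ⋙ (Functor.whiskeringRight J _ _).obj T.forget).IsRightAdjoint :=
    ((Adjunction.ofIsRightAdjoint (T.forget ⋙ Functor.const J)).ofNatIsoRight
      (Functor.compConstIso J T.forget)).isRightAdjoint
  exact isRightAdjoint_triangle_lift _ (T.adj.whiskerRight J)
    (T.adj.whiskerRightCounitRegularEpi T.adjCounitRegularEpi J)

theorem monadAlgebra_cocomplete {C : Type u} [Category.{v} C] (T : Monad C)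
    [HasColimits C] [HasCoequalizers T.Algebra] : HasColimits T.Algebra := by
  exact ⟨fun J _ => T.hasColimitsOfShape_algebra J⟩
end

section
/- Assume C is cocomplete. Let P : I → C^⊤, i ↦ P_i = (U P_i, α_i), be a small diagram of ⊤-algebras. Let can : colim_i U F U P_i → U F(colim_i U P_i) be the unique morphism of C satisfying inj_i ⋙ can = U F(inj_i) for all i ∈ I, where inj_i denote the colimit coprojections in C. Suppose the parallel pair of ⊤-algebra morphisms F(colim_i α_i) and ε_{F(colim_i U P_i)} ∘ F(can) : F(colim_i U F U P_i) ⇉ F(colim_i U P_i) has a coequalizer (Q, q : F(colim_i U P_i) → Q) in C^⊤. For each i ∈ I define In_i = U(q) ∘ η_{colim_i U P_i} ∘ inj_i : U P_i → U Q. Then each In_i underlies a morphism of ⊤-algebras P_i → Q, and Q together with these morphisms is a colimiting cocone of the diagram P in C^⊤. -/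
/-!
STATEMENT 3: Let ⊤ = (T, η, μ) be a monad on a cocomplete category C, with the
free–forgetful adjunction F ⊣ U between C and the Eilenberg–Moore category C^⊤.
Let P : I → C^⊤ be a small diagram of ⊤-algebras.  Let
`can : colim_i U F U P_i → U F (colim_i U P_i)` be the unique morphism with
`inj_i ≫ can = U F (inj_i)` (this is `colimit.post`).  Suppose the parallel
pair `F (colim_i α_i), ε_{F(colim_i U P_i)} ∘ F(can)` has a coequalizer (Q, q)
in C^⊤.  For each i set `In_i = U(q) ∘ η_{colim_i U P_i} ∘ inj_i`.  Then each
`In_i` underlies a morphism of ⊤-algebras `P_i → Q`, and Q together with these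
morphisms is a colimiting cocone of P in C^⊤.
-/

open CategoryTheory Limits

universe v u

namespace Stmt3

variable {C : Type u} [Category.{v} C] (T : Monad C)
variable {I : Type v} [SmallCategory I] (P : I ⥤ T.Algebra)

/-- The natural transformation `i ↦ α_i` from `i ↦ T (U P_i)` to `i ↦ U P_i`
whose components are the structure maps of the algebras `P_i`. -/
@[simps]
def structureNat : (P ⋙ T.forget) ⋙ T.toFunctor ⟶ P ⋙ T.forget where
  app i := (P.obj i).a
  naturality _ _ φ := (P.map φ).h

variable [HasColimits C]

/-- The first morphism of the parallel pair: `F (colim_i α_i)`. -/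
noncomputable def g₁ :
    T.free.obj (colimit ((P ⋙ T.forget) ⋙ T.toFunctor)) ⟶
      T.free.obj (colimit (P ⋙ T.forget)) :=
  T.free.map (colimMap (structureNat T P))

/-- The second morphism of the parallel pair:
`ε_{F(colim_i U P_i)} ∘ F(can)`, where `can = colimit.post` is the unique
morphism of `C` satisfying `inj_i ≫ can = U F (inj_i)` for all `i`. -/
noncomputable def g₂ :
    T.free.obj (colimit ((P ⋙ T.forget) ⋙ T.toFunctor)) ⟶
      T.free.obj (colimit (P ⋙ T.forget)) :=
  T.free.map (colimit.post (P ⋙ T.forget) T.toFunctor) ≫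
    T.adj.counit.app (T.free.obj (colimit (P ⋙ T.forget)))

end Stmt3

namespace Stmt3

section FreeAlgebra

variable {C : Type u} [Category.{v} C] {T : Monad C} {X Y : C} {A B : T.Algebra}

/-- The morphism of `C` underlying a morphism out of a free algebra. -/
def underlying (h : T.free.obj X ⟶ A) : T.obj X ⟶ A.A := h.f

/-- The restriction along the unit of a morphism out of a free algebra. -/
def transpose (h : T.free.obj X ⟶ A) : X ⟶ A.A := T.η.app X ≫ underlying h

lemma map_transpose_comp_a (h : T.free.obj X ⟶ A) :
    T.map (transpose h) ≫ A.a = underlying h := by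
  have e : T.map (underlying h) ≫ A.a = T.μ.app X ≫ underlying h := h.h
  rw [transpose, Functor.map_comp, Category.assoc, e]
  exact T.right_unit_assoc X (underlying h)

lemma transpose_injective :
    Function.Injective (transpose : (T.free.obj X ⟶ A) → (X ⟶ A.A)) := by
  intro h h' e
  ext
  change underlying h = underlying h'
  rw [← map_transpose_comp_a h, ← map_transpose_comp_a h', e]

lemma transpose_comp (h : T.free.obj X ⟶ A) (k : A ⟶ B) :
    transpose (h ≫ k) = transpose h ≫ k.f :=
  (Category.assoc _ _ _).symm

lemma transpose_free_map_comp (f : X ⟶ Y) (h : T.free.obj Y ⟶ A) :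
    transpose (T.free.map f ≫ h) = f ≫ transpose h :=
  (T.η.naturality_assoc f (underlying h)).symm

lemma transpose_counit (A : T.Algebra) :
    transpose (T.adj.counit.app A : T.free.obj A.A ⟶ A) = 𝟙 A.A := by
  have e : T.η.app A.A ≫ T.map (𝟙 A.A) ≫ A.a = 𝟙 A.A := by
    rw [CategoryTheory.Functor.map_id, Category.id_comp, A.unit]
  exact e

lemma transpose_counit_comp (h : T.free.obj X ⟶ A) :
    transpose (T.adj.counit.app (T.free.obj X) ≫ h) = underlying h := by
  refine (transpose_comp (T.adj.counit.app (T.free.obj X)) h).trans ?_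
  exact (congrArg (· ≫ underlying h) (transpose_counit (T.free.obj X))).trans (Category.id_comp _)

/-- The algebra morphism out of a free algebra extending a morphism of `C`. -/
def extend (k : X ⟶ A.A) : T.free.obj X ⟶ A := T.free.map k ≫ T.adj.counit.app A

lemma transpose_extend (k : X ⟶ A.A) : transpose (extend k : T.free.obj X ⟶ A) = k :=
  (transpose_free_map_comp k (T.adj.counit.app A)).trans
    ((congrArg (k ≫ ·) (transpose_counit A)).trans (Category.comp_id k))

end FreeAlgebra

variable {C : Type u} [Category.{v} C] {T : Monad C} [HasColimits C]
  {I : Type v} [SmallCategory I] (P : I ⥤ T.Algebra) {Q A : T.Algebra}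

lemma transpose_g₁_comp (h : T.free.obj (colimit (P ⋙ T.forget)) ⟶ A) :
    transpose (g₁ T P ≫ h) = colimMap (structureNat T P) ≫ transpose h :=
  transpose_free_map_comp _ h

lemma transpose_g₂_comp (h : T.free.obj (colimit (P ⋙ T.forget)) ⟶ A) :
    transpose (g₂ T P ≫ h) = colimit.post (P ⋙ T.forget) T.toFunctor ≫ underlying h := by
  rw [← transpose_counit_comp h]
  refine Eq.trans ?_ (transpose_free_map_comp _ _)
  exact congrArg transpose (Category.assoc _ _ _)

/-- A morphism out of `F (colim_i U P_i)` coequalizes `g₁` and `g₂` exactly when its transpose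
restricts to an algebra morphism along every coprojection. -/
lemma g₁_comp_eq_g₂_comp_iff (h : T.free.obj (colimit (P ⋙ T.forget)) ⟶ A) :
    g₁ T P ≫ h = g₂ T P ≫ h ↔
      ∀ i, T.map (colimit.ι (P ⋙ T.forget) i ≫ transpose h) ≫ A.a =
        (P.obj i).a ≫ colimit.ι (P ⋙ T.forget) i ≫ transpose h := by
  have h₁ (i : I) : colimit.ι ((P ⋙ T.forget) ⋙ T.toFunctor) i ≫ transpose (g₁ T P ≫ h) =
      (P.obj i).a ≫ colimit.ι (P ⋙ T.forget) i ≫ transpose h := by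
    rw [transpose_g₁_comp]
    exact ι_colimMap_assoc _ _ _
  have h₂ (i : I) : colimit.ι ((P ⋙ T.forget) ⋙ T.toFunctor) i ≫ transpose (g₂ T P ≫ h) =
      T.map (colimit.ι (P ⋙ T.forget) i ≫ transpose h) ≫ A.a := by
    rw [transpose_g₂_comp, colimit.ι_post_assoc, ← map_transpose_comp_a, ← Category.assoc,
      ← Functor.map_comp]
  constructor
  · intro e i
    exact (h₂ i).symm.trans ((congrArg (_ ≫ transpose ·) e.symm).trans (h₁ i))
  · intro e
    refine transpose_injective (colimit.hom_ext fun i => ?_)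
    exact (h₁ i).trans ((e i).symm.trans (h₂ i).symm)

/-- The natural transformation from `P` induced by a morphism coequalizing `g₁` and `g₂`. -/
noncomputable def coprojections (q : T.free.obj (colimit (P ⋙ T.forget)) ⟶ Q)
    (w : g₁ T P ≫ q = g₂ T P ≫ q) : P ⟶ (Functor.const I).obj Q where
  app i :=
    { f := colimit.ι (P ⋙ T.forget) i ≫ transpose q
      h := (g₁_comp_eq_g₂_comp_iff P q).1 w i }
  naturality i j φ := by
    ext
    exact (colimit.w_assoc (P ⋙ T.forget) φ (transpose q)).trans (Category.comp_id _).symm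

lemma coprojections_app_comp_f (q : T.free.obj (colimit (P ⋙ T.forget)) ⟶ Q)
    (w : g₁ T P ≫ q = g₂ T P ≫ q) (k : Q ⟶ A) (i : I) :
    ((coprojections P q w).app i ≫ k).f =
      colimit.ι (P ⋙ T.forget) i ≫ transpose (q ≫ k) := by
  rw [transpose_comp]
  exact Category.assoc _ _ _

/-- The algebra morphism `F (colim_i U P_i) ⟶ A` induced by a cocone on `P` with point `A`. -/
noncomputable def extendDesc (s : Cocone P) : T.free.obj (colimit (P ⋙ T.forget)) ⟶ s.pt :=
  extend (colimit.desc (P ⋙ T.forget) (T.forget.mapCocone s))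

lemma ι_transpose_extendDesc (s : Cocone P) (i : I) :
    colimit.ι (P ⋙ T.forget) i ≫ transpose (extendDesc P s) = (s.ι.app i).f :=
  (congrArg (_ ≫ ·) (transpose_extend _)).trans (colimit.ι_desc (T.forget.mapCocone s) i)

lemma g₁_comp_extendDesc (s : Cocone P) :
    g₁ T P ≫ extendDesc P s = g₂ T P ≫ extendDesc P s := by
  refine (g₁_comp_eq_g₂_comp_iff P _).2 fun i => ?_
  have e := ι_transpose_extendDesc P s i
  exact (congrArg (T.map · ≫ s.pt.a) e).trans
    ((s.ι.app i).h.trans (congrArg ((P.obj i).a ≫ ·) e.symm))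

/-- A coequalizer of `g₁` and `g₂` is a colimit of `P`. -/
noncomputable def isColimitOfCoequalizer (q : T.free.obj (colimit (P ⋙ T.forget)) ⟶ Q)
    (w : g₁ T P ≫ q = g₂ T P ≫ q) (hq : IsColimit (Cofork.ofπ q w)) :
    IsColimit (Cocone.mk Q (coprojections P q w)) where
  desc s := Cofork.IsColimit.desc hq (extendDesc P s) (g₁_comp_extendDesc P s)
  fac s i := by
    ext
    have e : q ≫ Cofork.IsColimit.desc hq (extendDesc P s) (g₁_comp_extendDesc P s) =
      extendDesc P s := Cofork.IsColimit.π_desc' hq _ _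
    refine (coprojections_app_comp_f P q w _ i).trans ?_
    exact (congrArg (_ ≫ transpose ·) e).trans (ι_transpose_extendDesc P s i)
  uniq s m hm := by
    refine Cofork.IsColimit.hom_ext hq ?_
    rw [Cofork.IsColimit.π_desc' hq]
    refine transpose_injective (colimit.hom_ext fun i => ?_)
    refine (coprojections_app_comp_f P q w m i).symm.trans ?_
    exact (congrArg Monad.Algebra.Hom.f (hm i)).trans (ι_transpose_extendDesc P s i).symm

end Stmt3

open Stmt3 in
theorem stmt3 {C : Type u} [Category.{v} C] (T : Monad C) [HasColimits C]
    {I : Type v} [SmallCategory I] (P : I ⥤ T.Algebra) (Q : T.Algebra)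
    (q : T.free.obj (colimit (P ⋙ T.forget)) ⟶ Q)
    (w : g₁ T P ≫ q = g₂ T P ≫ q)
    (hq : IsColimit (Cofork.ofπ q w)) :
    ∃ ι : P ⟶ (Functor.const I).obj Q,
      (∀ i, (ι.app i).f =
        colimit.ι (P ⋙ T.forget) i ≫ T.η.app (colimit (P ⋙ T.forget)) ≫ q.f) ∧
      Nonempty (IsColimit (Cocone.mk Q ι)) := by
  exact ⟨coprojections P q w, fun _ => rfl, ⟨isColimitOfCoequalizer P q w hq⟩⟩
end

section
/- Assume C is cocomplete. Let X be an object of C and A = (A₀, α : T A₀ → A₀) a ⊤-algebra. Consider the parallel pair of ⊤-algebra morphisms f, g : F(T A₀) ⇉ F(X ⊔ A₀), where f = ε_{F(X ⊔ A₀)} ∘ F(T ι₂) is the morphism corresponding under the adjunction F ⊣ U to T(ι₂) : T A₀ → T(X ⊔ A₀), g = F(ι₂) ∘ F(α), and ι₁ : X → X ⊔ A₀, ι₂ : A₀ → X ⊔ A₀ are the coprojections in C. Suppose (C₀, can : F(X ⊔ A₀) → C₀) is a coequalizer of (f, g) in C^⊤. Set In₁ = can ∘ F(ι₁) : F X → C₀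 and In₂ = U(can) ∘ η_{X ⊔ A₀} ∘ ι₂ : A₀ → U C₀. Then In₂ underlies a morphism of ⊤-algebras A → C₀, and (C₀, In₁, In₂) is a coproduct of F X and A in C^⊤. -/
/-!
STATEMENT 4: Let ⊤ = (T, η, μ) be a monad on a cocomplete category C, with the
free–forgetful adjunction F ⊣ U.  Let X be an object of C and A = (A₀, α) a
⊤-algebra.  Consider the parallel pair of ⊤-algebra morphisms
f, g : F(T A₀) ⇉ F(X ⊔ A₀), where f = ε_{F(X ⊔ A₀)} ∘ F(T ι₂) (the adjunct of
T ι₂) and g = F(ι₂) ∘ F(α).  Suppose (C₀, can) is a coequalizer of (f, g) in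
C^⊤.  Set In₁ = can ∘ F(ι₁) and In₂ = U(can) ∘ η_{X ⊔ A₀} ∘ ι₂.  Then In₂
underlies a morphism of ⊤-algebras A → C₀, and (C₀, In₁, In₂) is a coproduct
of F X and A in C^⊤.
-/

open CategoryTheory Limits

universe v u

namespace Stmt4

variable {C : Type u} [Category.{v} C] (T : Monad C) [HasColimits C]
variable (X : C) (A : T.Algebra)

/-- `f = ε_{F(X ⊔ A₀)} ∘ F(T ι₂)`, the ⊤-algebra morphism corresponding under
the adjunction `F ⊣ U` to `T ι₂ : T A₀ ⟶ T (X ⊔ A₀)`. -/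
noncomputable def fPair :
    T.free.obj (T.toFunctor.obj A.A) ⟶ T.free.obj (X ⨿ A.A) :=
  T.free.map (T.toFunctor.map (coprod.inr : A.A ⟶ X ⨿ A.A)) ≫
    T.adj.counit.app (T.free.obj (X ⨿ A.A))

/-- `g = F(ι₂) ∘ F(α)`. -/
noncomputable def gPair :
    T.free.obj (T.toFunctor.obj A.A) ⟶ T.free.obj (X ⨿ A.A) :=
  T.free.map A.a ≫ T.free.map (coprod.inr : A.A ⟶ X ⨿ A.A)

end Stmt4

namespace Stmt4

variable {C : Type u} [Category.{v} C] {T : Monad C}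

/-- The restriction of a morphism out of a free algebra along the unit of the monad. -/
def restrict {Y : C} {B : T.Algebra} (h : T.free.obj Y ⟶ B) : Y ⟶ B.A :=
  T.η.app Y ≫ h.f

/-- The algebra morphism out of a free algebra extending a given morphism of `C`. -/
def extend {Y : C} {B : T.Algebra} (φ : Y ⟶ B.A) : T.free.obj Y ⟶ B :=
  (T.adj.homEquiv Y B).symm φ

lemma restrict_eq_homEquiv {Y : C} {B : T.Algebra} (h : T.free.obj Y ⟶ B) :
    restrict h = T.adj.homEquiv Y B h := by
  rw [Adjunction.homEquiv_unit, Monad.adj_unit]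
  rfl

lemma restrict_injective {Y : C} {B : T.Algebra} {h k : T.free.obj Y ⟶ B}
    (e : restrict h = restrict k) : h = k :=
  (T.adj.homEquiv Y B).injective (by rwa [← restrict_eq_homEquiv, ← restrict_eq_homEquiv])

lemma restrict_extend {Y : C} {B : T.Algebra} (φ : Y ⟶ B.A) : restrict (extend φ) = φ :=
  (restrict_eq_homEquiv _).trans ((T.adj.homEquiv Y B).apply_symm_apply φ)

lemma restrict_comp {Y : C} {B B' : T.Algebra} (h : T.free.obj Y ⟶ B) (k : B ⟶ B') :
    restrict (h ≫ k) = restrict h ≫ k.f :=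
  (Category.assoc (T.η.app Y) h.f k.f).symm

lemma restrict_free_map_comp {Y Z : C} {B : T.Algebra} (i : Z ⟶ Y) (h : T.free.obj Y ⟶ B) :
    restrict (T.free.map i ≫ h) = i ≫ restrict h :=
  (T.η.naturality_assoc i h.f).symm

/-- The underlying morphism of a morphism out of a free algebra, with the carrier of the free
algebra unfolded. -/
def underlying {Y : C} {B : T.Algebra} (h : T.free.obj Y ⟶ B) : T.obj Y ⟶ B.A :=
  h.f

lemma map_restrict_comp_a {Y : C} {B : T.Algebra} (h : T.free.obj Y ⟶ B) :
    T.map (restrict h) ≫ B.a = underlying h := by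
  have e : T.map (underlying h) ≫ B.a = T.μ.app Y ≫ underlying h := h.h
  change T.map (T.η.app Y ≫ underlying h) ≫ B.a = underlying h
  rw [Functor.map_comp, Category.assoc, e]
  exact Monad.right_unit_assoc T Y (underlying h)

lemma restrict_counit_comp {Y : C} {B : T.Algebra} (h : T.free.obj Y ⟶ B) :
    restrict (T.adj.counit.app (T.free.obj Y) ≫ h) = underlying h := by
  have e : (T.adj.counit.app (T.free.obj Y)).f = T.μ.app Y := by
    rw [Monad.adj_counit]
    rfl
  change T.η.app (T.obj Y) ≫ (T.adj.counit.app (T.free.obj Y)).f ≫ underlying h = underlying h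
  rw [e]
  exact Monad.left_unit_assoc T Y (underlying h)

variable [HasColimits C] {X : C} {A : T.Algebra}

lemma restrict_fPair_comp {B : T.Algebra} (h : T.free.obj (X ⨿ A.A) ⟶ B) :
    restrict (fPair T X A ≫ h) = T.map (coprod.inr : A.A ⟶ X ⨿ A.A) ≫ underlying h := by
  rw [← restrict_counit_comp]
  refine Eq.trans ?_ (restrict_free_map_comp (T.map (coprod.inr : A.A ⟶ X ⨿ A.A)) _)
  exact congrArg restrict (Category.assoc _ _ _)

lemma restrict_gPair_comp {B : T.Algebra} (h : T.free.obj (X ⨿ A.A) ⟶ B) :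
    restrict (gPair T X A ≫ h) = A.a ≫ (coprod.inr : A.A ⟶ X ⨿ A.A) ≫ restrict h := by
  rw [gPair, Category.assoc, restrict_free_map_comp, restrict_free_map_comp]

/-- A morphism out of `F (X ⨿ A₀)` coequalizes the pair exactly when its restriction to `A₀` is a
morphism of algebras. -/
lemma fPair_comp_eq_gPair_comp_iff {B : T.Algebra} (h : T.free.obj (X ⨿ A.A) ⟶ B) :
    fPair T X A ≫ h = gPair T X A ≫ h ↔
      T.map ((coprod.inr : A.A ⟶ X ⨿ A.A) ≫ restrict h) ≫ B.a =
        A.a ≫ (coprod.inr : A.A ⟶ X ⨿ A.A) ≫ restrict h := by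
  rw [Functor.map_comp, Category.assoc, map_restrict_comp_a, ← restrict_fPair_comp,
    ← restrict_gPair_comp]
  exact ⟨fun e => by rw [e], restrict_injective⟩

end Stmt4

open Stmt4 in
theorem stmt4 {C : Type u} [Category.{v} C] (T : Monad C) [HasColimits C]
    (X : C) (A : T.Algebra) (C₀ : T.Algebra)
    (can : T.free.obj (X ⨿ A.A) ⟶ C₀)
    (w : fPair T X A ≫ can = gPair T X A ≫ can)
    (hc : IsColimit (Cofork.ofπ can w)) :
    ∃ In₂ : A ⟶ C₀,
      In₂.f = (coprod.inr : A.A ⟶ X ⨿ A.A) ≫ T.η.app (X ⨿ A.A) ≫ can.f ∧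
      Nonempty (IsColimit (BinaryCofan.mk
        (T.free.map (coprod.inl : X ⟶ X ⨿ A.A) ≫ can) In₂)) := by
  let In₂ : A ⟶ C₀ := ⟨coprod.inr ≫ restrict can, (fPair_comp_eq_gPair_comp_iff can).1 w⟩
  have coeq {B : T.Algebra} (p : T.free.obj X ⟶ B) (q : A ⟶ B) :
      fPair T X A ≫ extend (coprod.desc (restrict p) q.f) =
        gPair T X A ≫ extend (coprod.desc (restrict p) q.f) := by
    rw [fPair_comp_eq_gPair_comp_iff, restrict_extend, coprod.inr_desc]
    exact q.h
  have fac {B : T.Algebra} (p : T.free.obj X ⟶ B) (q : A ⟶ B) :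
      can ≫ hc.desc (Cofork.ofπ _ (coeq p q)) = extend (coprod.desc (restrict p) q.f) :=
    hc.fac _ WalkingParallelPair.one
  have In₂_comp {B : T.Algebra} (m : C₀ ⟶ B) :
      (In₂ ≫ m).f = coprod.inr ≫ restrict (can ≫ m) := by
    rw [restrict_comp]
    exact Category.assoc _ _ _
  refine ⟨In₂, rfl, ⟨BinaryCofan.IsColimit.mk _ (fun p q => hc.desc (Cofork.ofπ _ (coeq p q)))
    (fun p q => ?_) (fun p q => ?_) (fun p q m h₁ h₂ => ?_)⟩⟩
  · apply restrict_injective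
    refine (congrArg restrict (Category.assoc _ _ _)).trans ?_
    rw [restrict_free_map_comp]
    erw [fac]
    rw [restrict_extend, coprod.inl_desc]
  · ext
    refine (In₂_comp _).trans ?_
    erw [fac]
    rw [restrict_extend, coprod.inr_desc]
  · refine Cofork.IsColimit.hom_ext hc ?_
    refine Eq.trans ?_ (fac p q).symm
    apply restrict_injective
    rw [restrict_extend]
    apply coprod.hom_ext
    · rw [coprod.inl_desc, ← h₁, ← restrict_free_map_comp]
      exact congrArg restrict (Category.assoc _ _ _).symm
    · rw [coprod.inr_desc, ← h₂]
      exact (In₂_comp m).symm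
end

section
/- Let X be an object of the cocomplete category C, let A = (A₀, α : T A₀ → A₀) be a ⊤-algebra, and let (C₀, can : F(X ⊔ A₀) → C₀) be, as above, the coequalizer in C^⊤ of the pair f = ε_{F(X ⊔ A₀)} ∘ F(T ι₂) and g = F(ι₂) ∘ F(α) : F(T A₀) ⇉ F(X ⊔ A₀) (so C₀ = F X ⊔ A). Then for every ⊤-algebra Q and every morphism of ⊤-algebras γ : F(X ⊔ A₀) → Q such that the C-morphism U(γ) ∘ η_{X ⊔ A₀} ∘ ι₂ : A₀ → U Q underlies a morphism of ⊤-algebras A → Q, there is a unique morphism of ⊤-algebras ψ : C₀ → Q with γ = ψ ∘ can. In other words, F X ⊔ A is the largest quotient of F(X ⊔ A₀) on which the canonical map from A becomes a morphism of ⊤-algebras. -/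
/-!
STATEMENT 5: Let ⊤ = (T, η, μ) be a monad on a cocomplete category C, with the
free–forgetful adjunction F ⊣ U.  Let X ∈ C, A = (A₀, α) a ⊤-algebra, and let
(C₀, can : F(X ⊔ A₀) → C₀) be the coequalizer in C^⊤ of the pair
f = ε_{F(X ⊔ A₀)} ∘ F(T ι₂), g = F(ι₂) ∘ F(α) (so C₀ = F X ⊔ A).  Then for
every ⊤-algebra Q and every ⊤-algebra morphism γ : F(X ⊔ A₀) → Q such that
the C-morphism U(γ) ∘ η_{X ⊔ A₀} ∘ ι₂ : A₀ → U Q underlies a morphism of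
⊤-algebras A → Q, there is a unique ⊤-algebra morphism ψ : C₀ → Q with
γ = ψ ∘ can.
-/

open CategoryTheory Limits

universe v u

namespace Stmt5

variable {C : Type u} [Category.{v} C] (T : Monad C) [HasColimits C]
variable (X : C) (A : T.Algebra)

/-- `f = ε_{F(X ⊔ A₀)} ∘ F(T ι₂)`, the ⊤-algebra morphism corresponding under
the adjunction `F ⊣ U` to `T ι₂ : T A₀ ⟶ T (X ⊔ A₀)`. -/
noncomputable def fPair :
    T.free.obj (T.toFunctor.obj A.A) ⟶ T.free.obj (X ⨿ A.A) :=
  T.free.map (T.toFunctor.map (coprod.inr : A.A ⟶ X ⨿ A.A)) ≫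
    T.adj.counit.app (T.free.obj (X ⨿ A.A))

/-- `g = F(ι₂) ∘ F(α)`. -/
noncomputable def gPair :
    T.free.obj (T.toFunctor.obj A.A) ⟶ T.free.obj (X ⨿ A.A) :=
  T.free.map A.a ≫ T.free.map (coprod.inr : A.A ⟶ X ⨿ A.A)

end Stmt5

namespace Stmt5

variable {C : Type u} [Category.{v} C] (T : Monad C)

/-- If the restriction of an algebra map `g : T Y ⟶ Q` along `i : A ⟶ Y` underlies an algebra
morphism, then `g` identifies `T i` with `i` composed with the structure map of `A`. -/
lemma map_comp_eq_of_hom {Y : C} {A Q : T.Algebra} (i : A.A ⟶ Y) (g : T.toFunctor.obj Y ⟶ Q.A)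
    (hg : T.toFunctor.map g ≫ Q.a = T.μ.app Y ≫ g) (φ : A ⟶ Q)
    (hφ : φ.f = i ≫ T.η.app Y ≫ g) :
    T.toFunctor.map i ≫ g = A.a ≫ i ≫ T.η.app Y ≫ g := by
  rw [← hφ, ← φ.h, hφ]
  simp [hg]

variable [HasColimits C] (X : C) (A : T.Algebra)

lemma unit_comp_fPair_f :
    T.η.app (T.toFunctor.obj A.A) ≫ (fPair T X A).f =
      T.toFunctor.map (coprod.inr : A.A ⟶ X ⨿ A.A) := by
  have h : (fPair T X A).f = T.toFunctor.map (T.toFunctor.map coprod.inr) ≫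
      T.μ.app (X ⨿ A.A) := by
    rw [fPair, T.adj_counit]
    rfl
  have hμ := (Monad.unit_naturality_assoc C T (T.toFunctor.map (coprod.inr : A.A ⟶ X ⨿ A.A))
    (T.μ.app (X ⨿ A.A))).symm
  rw [T.left_unit] at hμ
  exact (congrArg (T.η.app _ ≫ ·) h).trans (hμ.trans (Category.comp_id _))

lemma unit_comp_gPair_f :
    T.η.app (T.toFunctor.obj A.A) ≫ (gPair T X A).f =
      A.a ≫ coprod.inr ≫ T.η.app (X ⨿ A.A) := by
  have h := T.η.naturality (A.a ≫ (coprod.inr : A.A ⟶ X ⨿ A.A))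
  simp only [Functor.id_map, Category.assoc, Functor.map_comp] at h
  exact h.symm

/-- A morphism out of `F (X ⨿ A₀)` coequalizes the pair as soon as its restriction to `A₀`
underlies a morphism of algebras. -/
lemma fPair_comp_eq_gPair_comp {Q : T.Algebra} (γ : T.free.obj (X ⨿ A.A) ⟶ Q) (φ : A ⟶ Q)
    (hφ : φ.f = (coprod.inr : A.A ⟶ X ⨿ A.A) ≫ T.η.app (X ⨿ A.A) ≫ γ.f) :
    fPair T X A ≫ γ = gPair T X A ≫ γ := by
  apply (T.adj.homEquiv _ _).injective
  rw [T.adj.homEquiv_unit, T.adj.homEquiv_unit, T.adj_unit]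
  have hf := congrArg (· ≫ γ.f) (unit_comp_fPair_f T X A)
  have hg := congrArg (· ≫ γ.f) (unit_comp_gPair_f T X A)
  have hfg := (map_comp_eq_of_hom T coprod.inr γ.f γ.h φ hφ).trans
    ((congrArg (A.a ≫ ·) (Category.assoc _ _ _).symm).trans (Category.assoc _ _ _).symm)
  exact (Category.assoc _ _ _).symm.trans
    (hf.trans (hfg.trans (hg.symm.trans (Category.assoc _ _ _))))

end Stmt5

open Stmt5 in
theorem stmt5 {C : Type u} [Category.{v} C] (T : Monad C) [HasColimits C]
    (X : C) (A : T.Algebra) (C₀ : T.Algebra)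
    (can : T.free.obj (X ⨿ A.A) ⟶ C₀)
    (w : fPair T X A ≫ can = gPair T X A ≫ can)
    (hc : IsColimit (Cofork.ofπ can w)) :
    ∀ (Q : T.Algebra) (γ : T.free.obj (X ⨿ A.A) ⟶ Q),
      (∃ φ : A ⟶ Q,
        φ.f = (coprod.inr : A.A ⟶ X ⨿ A.A) ≫ T.η.app (X ⨿ A.A) ≫ γ.f) →
      ∃! ψ : C₀ ⟶ Q, can ≫ ψ = γ := by
  rintro Q γ ⟨φ, hφ⟩
  obtain ⟨ψ, hψ⟩ := Cofork.IsColimit.desc' hc γ (fPair_comp_eq_gPair_comp T X A γ φ hφ)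
  exact ⟨ψ, hψ, fun ψ' hψ' => Cofork.IsColimit.hom_ext hc (hψ'.trans hψ.symm)⟩
end

section
/- Let 𝔸 = (A, η^𝔸, μ^𝔸) and 𝔹 = (B, η^𝔹, μ^𝔹) be monads on a category C and f : 𝔸 → 𝔹 a morphism of monads. Let (P, α) be an 𝔸-algebra. Suppose the parallel pair of 𝔹-algebra morphisms F_𝔹(α) and f_P^♯ : F_𝔹(A P) ⇉ F_𝔹(P) — where f_P^♯ is the 𝔹-algebra morphism corresponding under the free–forgetful adjunction F_𝔹 ⊣ U_𝔹 to f_P : A P → B P — has a coequalizer (Q, q) in the category of 𝔹-algebras. Then for every 𝔹-algebra R the assignment h ↦ U_𝔹(h) ∘ U_𝔹(q) ∘ η^𝔹_P is a well-defined bijection, natural in R, from 𝔹-algebra morphisms Q → R to 𝔸-algebra morphisms (P, α) → f^*(R). -/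
/-!
STATEMENT 6: Let 𝔸 and 𝔹 be monads on a category C and f : 𝔸 → 𝔹 a morphism of
monads.  Let (P, α) be an 𝔸-algebra.  Suppose the parallel pair of 𝔹-algebra
morphisms F_𝔹(α), f_P^♯ : F_𝔹(A P) ⇉ F_𝔹(P) — where f_P^♯ is the 𝔹-algebra
morphism corresponding under F_𝔹 ⊣ U_𝔹 to f_P : A P → B P — has a coequalizer
(Q, q) in the category of 𝔹-algebras.  Then for every 𝔹-algebra R the
assignment h ↦ U_𝔹(h) ∘ U_𝔹(q) ∘ η^𝔹_P is a well-defined bijection, natural in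
R, from 𝔹-algebra morphisms Q → R to 𝔸-algebra morphisms (P, α) → f^*(R),
where f^* is the restriction of scalars along f
(i.e. `Monad.algebraFunctorOfMonadHom f`, sending (R, β) to (R, β ∘ f_R)).
-/

open CategoryTheory Limits

universe v u

namespace CategoryTheory.Monad

variable {C : Type u} [Category.{v} C] {M N : Monad C}

theorem map_eta_comp_comp_a {P : C} {R : N.Algebra} {k : N.obj P ⟶ R.A}
    (hk : N.map k ≫ R.a = N.μ.app P ≫ k) : N.map (N.η.app P ≫ k) ≫ R.a = k := by
  rw [Functor.map_comp, Category.assoc, hk]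
  exact N.right_unit_assoc P k

theorem free_hom_ext {X : C} {R : N.Algebra} {k l : N.free.obj X ⟶ R}
    (h : N.η.app X ≫ k.f = N.η.app X ≫ l.f) : k = l :=
  Algebra.Hom.ext ((map_eta_comp_comp_a k.h).symm.trans
    ((congrArg (fun t => N.map t ≫ R.a) h).trans (map_eta_comp_comp_a l.h)))

theorem eta_comp_homEquiv_symm_f {X : C} {R : N.Algebra} (g : X ⟶ R.A) :
    N.η.app X ≫ ((N.adj.homEquiv X R).symm g).f = g := by
  have h := (N.adj.homEquiv X R).apply_symm_apply g
  rwa [Adjunction.homEquiv_unit, adj_unit] at h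

theorem adj_counit_app_free_f (X : C) :
    (N.adj.counit.app (N.free.obj X)).f = N.μ.app X := by
  rw [adj_counit]
  rfl

theorem map_eta_comp_comp_app (f : M ⟶ N) {P : C} {R : N.Algebra} {k : N.obj P ⟶ R.A}
    (hk : N.map k ≫ R.a = N.μ.app P ≫ k) :
    M.map (N.η.app P ≫ k) ≫ f.app R.A ≫ R.a = f.app P ≫ k := by
  rw [f.naturality_assoc, map_eta_comp_comp_a hk]
  rfl

/-- A morphism out of a free algebra coequalizes the pair defining extension of scalars exactly when
its transpose is a morphism into the restriction of scalars. -/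
theorem coequalizes_iff_isAlgebraHom (f : M ⟶ N) (P : M.Algebra) (R : N.Algebra)
    (k : N.free.obj P.A ⟶ R) :
    N.free.map P.a ≫ k =
        (N.free.map (f.app P.A) ≫ N.adj.counit.app (N.free.obj P.A)) ≫ k ↔
      M.map (N.η.app P.A ≫ k.f) ≫ f.app R.A ≫ R.a = P.a ≫ N.η.app P.A ≫ k.f := by
  have left : N.η.app (M.obj P.A) ≫ (N.free.map P.a ≫ k).f = P.a ≫ N.η.app P.A ≫ k.f :=
    (N.η.naturality_assoc P.a k.f).symm
  have right : N.η.app (M.obj P.A) ≫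
      ((N.free.map (f.app P.A) ≫ N.adj.counit.app (N.free.obj P.A)) ≫ k).f =
        f.app P.A ≫ k.f := by
    change N.η.app (M.obj P.A) ≫ (N.map (f.app P.A) ≫
      (N.adj.counit.app (N.free.obj P.A)).f) ≫ k.f = _
    rw [adj_counit_app_free_f]
    refine (congrArg (N.η.app (M.obj P.A) ≫ ·) (Category.assoc _ _ _)).trans ?_
    exact (N.η.naturality_assoc (f.app P.A) (N.μ.app P.A ≫ k.f)).symm.trans
      (congrArg (f.app P.A ≫ ·) (N.left_unit_assoc P.A k.f))
  have transpose : M.map (N.η.app P.A ≫ k.f) ≫ f.app R.A ≫ R.a = f.app P.A ≫ k.f :=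
    map_eta_comp_comp_app f k.h
  rw [transpose, ← left, ← right]
  exact ⟨fun h => by rw [h], fun h => free_hom_ext h.symm⟩

/-- Morphisms out of a coequalizer presenting extension of scalars along `f` correspond to morphisms
into restriction of scalars. -/
noncomputable def extendScalarsHomEquiv (f : M ⟶ N) (P : M.Algebra) (Q : N.Algebra)
    (q : N.free.obj P.A ⟶ Q)
    (w : N.free.map P.a ≫ q =
      (N.free.map (f.app P.A) ≫ N.adj.counit.app (N.free.obj P.A)) ≫ q)
    (hq : IsColimit (Cofork.ofπ q w)) (R : N.Algebra) :
    (Q ⟶ R) ≃ (P ⟶ (algebraFunctorOfMonadHom f).obj R) where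
  toFun h :=
    { f := N.η.app P.A ≫ q.f ≫ h.f
      h := (coequalizes_iff_isAlgebraHom f P R (q ≫ h)).1
        ((Category.assoc _ _ _).symm.trans ((congrArg (· ≫ h) w).trans (Category.assoc _ _ _))) }
  invFun g := Cofork.IsColimit.desc hq ((N.adj.homEquiv P.A R).symm g.f)
    ((coequalizes_iff_isAlgebraHom f P R _).2 (by
      rw [eta_comp_homEquiv_symm_f (N := N) (R := R) g.f]
      exact g.h))
  left_inv h := by
    refine Cofork.IsColimit.hom_ext hq ?_
    rw [Cofork.IsColimit.π_desc']
    exact free_hom_ext (eta_comp_homEquiv_symm_f _)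
  right_inv g := by
    ext
    exact (congrArg (fun k : N.free.obj P.A ⟶ R => N.η.app P.A ≫ k.f)
      (Cofork.IsColimit.π_desc' hq _ _)).trans
        (eta_comp_homEquiv_symm_f (N := N) (R := R) g.f)

end CategoryTheory.Monad

theorem stmt6 {C : Type u} [Category.{v} C] {M N : Monad C} (f : M ⟶ N)
    (P : M.Algebra) (Q : N.Algebra)
    (q : N.free.obj P.A ⟶ Q)
    (w : N.free.map P.a ≫ q =
      (N.free.map (f.app P.A) ≫ N.adj.counit.app (N.free.obj P.A)) ≫ q)
    (hq : IsColimit (Cofork.ofπ q w)) :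
    ∃ e : ∀ R : N.Algebra,
        (Q ⟶ R) ≃ (P ⟶ (Monad.algebraFunctorOfMonadHom f).obj R),
      (∀ (R : N.Algebra) (h : Q ⟶ R),
        ((e R) h).f = N.η.app P.A ≫ q.f ≫ h.f) ∧
      (∀ (R R' : N.Algebra) (g : R ⟶ R') (h : Q ⟶ R),
        e R' (h ≫ g) = e R h ≫ (Monad.algebraFunctorOfMonadHom f).map g) := by
  refine ⟨Monad.extendScalarsHomEquiv f P Q q w hq, fun _ _ => rfl, fun R R' g h => ?_⟩
  ext
  exact (congrArg (N.η.app P.A ≫ ·) (Category.assoc _ _ _).symm).trans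
    (Category.assoc _ _ _).symm
end
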